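/- Let A : H → 2^H be maximally monotone and let C : H → H be monotone, continuous, and defined on all of H. Then A + C is maximally monotone. -/

import Mathlib

open RealInnerProductSpace

/-- A set-valued operator is monotone. -/
def MonotoneOp {H : Type*} [NormedAddCommGroup H] [InnerProductSpace ℝ H]
    (A : H → Set H) : Prop :=
  ∀ x y u v, u ∈ A x → v ∈ A y → 0 ≤ ⟪x - y, u - v⟫

/-- A set-valued operator is maximally monotone: it is monotone and any pair
monotonically related to its graph belongs to its graph. -/
def MaximallyMonotoneOp {H : Type*} [NormedAddCommGroup H] [InnerProductSpace ℝ H]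
    (A : H → Set H) : Prop :=
  MonotoneOp A ∧ ∀ x u, (∀ y v, v ∈ A y → 0 ≤ ⟪x - y, u - v⟫) → u ∈ A x

open Filter Topology

section Minimization

theorem cauchySeq_of_norm_sub_sq_le {E : Type*} [SeminormedAddCommGroup E] {x : ℕ → E} {c : ℝ}
    (h : ∀ n m : ℕ, ‖x n - x m‖ ^ 2 ≤ c * (1 / ((n : ℝ) + 1) + 1 / ((m : ℝ) + 1))) :
    CauchySeq x := by
  have hc : 0 ≤ c := by
    have h0 := (sq_nonneg _).trans (h 0 0)
    norm_num at h0
    exact h0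
  refine cauchySeq_of_le_tendsto_0 (fun N : ℕ => √(2 * c * (1 / ((N : ℝ) + 1)))) ?_ ?_
  · intro n m N hn hm
    rw [dist_eq_norm]
    apply Real.le_sqrt_of_sq_le
    have h1 : 1 / ((n : ℝ) + 1) ≤ 1 / ((N : ℝ) + 1) := one_div_le_one_div_of_le (by positivity)
      (by gcongr)
    have h2 : 1 / ((m : ℝ) + 1) ≤ 1 / ((N : ℝ) + 1) := one_div_le_one_div_of_le (by positivity)
      (by gcongr)
    calc _ ≤ _ := h n m
      _ ≤ c * (1 / ((N : ℝ) + 1) + 1 / ((N : ℝ) + 1)) := by gcongr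
      _ = _ := by ring
  · have h1 := (tendsto_one_div_add_atTop_nhds_zero_nat (𝕜 := ℝ)).const_mul (2 * c)
    simpa using h1.sqrt

variable {E : Type*} [NormedAddCommGroup E] [InnerProductSpace ℝ E]

/-- For `S` the epigraph of a closed convex function `f` with `f + ‖·‖² / 2` nonnegative, this says that
there is a point `p` at which `-p` is a subgradient of `f`. -/
theorem exists_neg_subgradient [CompleteSpace E] {S : Set (E × ℝ)} (hne : S.Nonempty)
    (hcl : IsClosed S) (hcv : Convex ℝ S) (hbd : ∀ p ∈ S, 0 ≤ p.2 + ‖p.1‖ ^ 2 / 2) :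
    ∃ p ∈ S, ∀ q ∈ S, 0 ≤ q.2 - p.2 + ⟪p.1, q.1 - p.1⟫ := by
  set val : E × ℝ → ℝ := fun p => p.2 + ‖p.1‖ ^ 2 / 2 with hval
  set m := sInf (val '' S)
  have hbdd : BddBelow (val '' S) := ⟨0, by rintro _ ⟨p, hp, rfl⟩; exact hbd p hp⟩
  have hle : ∀ p ∈ S, m ≤ val p := fun p hp => csInf_le hbdd ⟨p, hp, rfl⟩
  have hex : ∀ n : ℕ, ∃ p ∈ S, val p < m + 1 / ((n : ℝ) + 1) := by
    intro n
    obtain ⟨_, ⟨p, hp, rfl⟩, hlt⟩ := exists_lt_of_csInf_lt (hne.image val)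
      (show sInf (val '' S) < m + 1 / ((n : ℝ) + 1) by
        have : 0 < 1 / ((n : ℝ) + 1) := by positivity
        linarith)
    exact ⟨p, hp, hlt⟩
  choose p hpS hpv using hex
  have hcau : CauchySeq fun n => (p n).1 := by
    refine cauchySeq_of_norm_sub_sq_le (c := 4) fun i j => ?_
    have hmid := hle _ (hcv (hpS i) (hpS j) (by norm_num : (0 : ℝ) ≤ 1 / 2)
      (by norm_num : (0 : ℝ) ≤ 1 / 2) (by norm_num))
    have hi := hpv i
    have hj := hpv j
    have e1 := norm_add_sq_real ((1 / 2 : ℝ) • (p i).1) ((1 / 2 : ℝ) • (p j).1)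
    have e2 := norm_sub_sq_real (p i).1 (p j).1
    simp only [norm_smul, real_inner_smul_left, real_inner_smul_right] at e1
    norm_num at e1
    simp only [hval, Prod.fst_add, Prod.snd_add, Prod.smul_fst, Prod.smul_snd, smul_eq_mul]
      at hmid hi hj
    nlinarith
  obtain ⟨x, hx⟩ := cauchySeq_tendsto_of_complete hcau
  have hvlim : Tendsto (fun n => val (p n)) atTop (𝓝 m) := by
    refine tendsto_of_tendsto_of_tendsto_of_le_of_le tendsto_const_nhds ?_
      (fun n => hle _ (hpS n)) (fun n => (hpv n).le)
    simpa using (tendsto_one_div_add_atTop_nhds_zero_nat (𝕜 := ℝ)).const_add m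
  have hr : Tendsto (fun n => (p n).2) atTop (𝓝 (m - ‖x‖ ^ 2 / 2)) := by
    refine (hvlim.sub ((hx.norm.pow 2).div_const 2)).congr fun n => ?_
    simp [hval]
  have hmem : (x, m - ‖x‖ ^ 2 / 2) ∈ S :=
    hcl.mem_of_tendsto (hx.prodMk_nhds hr) (Eventually.of_forall hpS)
  refine ⟨_, hmem, fun q hq => ?_⟩
  have hseg : ∀ t : ℝ, 0 < t → t ≤ 1 →
      0 ≤ (q.2 - (m - ‖x‖ ^ 2 / 2) + ⟪x, q.1 - x⟫) + t * (‖q.1 - x‖ ^ 2 / 2) := by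
    intro t ht ht1
    have h1 := hle _ (hcv.add_smul_sub_mem hmem hq ⟨ht.le, ht1⟩)
    have e1 := norm_add_sq_real x (t • (q.1 - x))
    simp only [norm_smul, real_inner_smul_right, mul_pow, Real.norm_eq_abs, sq_abs] at e1
    simp only [hval, Prod.fst_add, Prod.snd_add, Prod.smul_fst, Prod.smul_snd, smul_eq_mul,
      Prod.fst_sub, Prod.snd_sub] at h1
    refine nonneg_of_mul_nonneg_right (a := t) ?_ ht
    nlinarith
  have hlim : Tendsto (fun t : ℝ => (q.2 - (m - ‖x‖ ^ 2 / 2) + ⟪x, q.1 - x⟫)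
      + t * (‖q.1 - x‖ ^ 2 / 2)) (𝓝[>] 0) (𝓝 (q.2 - (m - ‖x‖ ^ 2 / 2) + ⟪x, q.1 - x⟫)) := by
    refine tendsto_nhdsWithin_of_tendsto_nhds ?_
    have : Continuous (fun t : ℝ => (q.2 - (m - ‖x‖ ^ 2 / 2) + ⟪x, q.1 - x⟫)
      + t * (‖q.1 - x‖ ^ 2 / 2)) := by fun_prop
    simpa using this.tendsto 0
  refine ge_of_tendsto hlim ?_
  filter_upwards [Ioc_mem_nhdsGT (zero_lt_one' ℝ)] with t ht
  exact hseg t ht.1 ht.2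

end Minimization

section Operators

variable {H : Type*} [NormedAddCommGroup H] [InnerProductSpace ℝ H]

theorem MaximallyMonotoneOp.exists_mem {A : H → Set H} (hA : MaximallyMonotoneOp A) :
    ∃ x u, u ∈ A x := by
  by_contra! h
  exact h 0 0 (hA.2 0 0 fun y v hv => (h y v hv).elim)

theorem MaximallyMonotoneOp.mem_of_tendsto {A : H → Set H} (hA : MaximallyMonotoneOp A)
    {x u : ℕ → H} {a b : H} (hx : Tendsto x atTop (𝓝 a)) (hu : Tendsto u atTop (𝓝 b))
    (h : ∀ n, u n ∈ A (x n)) : b ∈ A a :=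
  hA.2 a b fun y v hv =>
    ge_of_tendsto' ((hx.sub_const y).inner (hu.sub_const v)) fun n => hA.1 _ _ _ _ (h n) hv

theorem MaximallyMonotoneOp.exists_neg_mem [CompleteSpace H] {A : H → Set H}
    (hA : MaximallyMonotoneOp A) : ∃ x, -x ∈ A x := by
  set S : Set (WithLp 2 (H × H) × ℝ) :=
    {p | ∀ y v, v ∈ A y → ⟪p.1.fst, v⟫ + ⟪y, p.1.snd⟫ - ⟪y, v⟫ ≤ p.2} with hS
  have hgraph : ∀ y v, v ∈ A y → (WithLp.toLp 2 (y, v), ⟪y, v⟫) ∈ S := by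
    intro y v hv z w hw
    have := hA.1 y z v w hv hw
    simp only [inner_sub_left, inner_sub_right] at this
    change ⟪y, w⟫ + ⟪z, v⟫ - ⟪z, w⟫ ≤ ⟪y, v⟫
    linarith
  have hge : ∀ p ∈ S, ⟪p.1.fst, p.1.snd⟫ ≤ p.2 := by
    intro p hp
    by_contra! hlt
    have hmem : p.1.snd ∈ A p.1.fst := by
      refine hA.2 _ _ fun y v hv => ?_
      have := hp y v hv
      simp only [inner_sub_left, inner_sub_right]
      linarith
    have := hp _ _ hmem
    linarith
  obtain ⟨p, hp, hmin⟩ : ∃ p ∈ S, ∀ q ∈ S, 0 ≤ q.2 - p.2 + ⟪p.1, q.1 - p.1⟫ := by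
    refine exists_neg_subgradient ?_ ?_ ?_ ?_
    · obtain ⟨y, v, hv⟩ := hA.exists_mem
      exact ⟨_, hgraph y v hv⟩
    · simp only [hS, Set.ofPred_forall]
      refine isClosed_iInter fun y => isClosed_iInter fun v => isClosed_iInter fun _ => ?_
      have h1 : Continuous fun p : WithLp 2 (H × H) × ℝ => p.1.fst :=
        (WithLp.prod_continuous_ofLp 2 H H).fst.comp continuous_fst
      have h2 : Continuous fun p : WithLp 2 (H × H) × ℝ => p.1.snd :=
        (WithLp.prod_continuous_ofLp 2 H H).snd.comp continuous_fst
      exact isClosed_le (by fun_prop) continuous_snd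
    · intro p hp q hq a b ha hb hab y v hv
      have h1 := mul_le_mul_of_nonneg_left (hp y v hv) ha
      have h2 := mul_le_mul_of_nonneg_left (hq y v hv) hb
      have h3 : ⟪y, v⟫ = a * ⟪y, v⟫ + b * ⟪y, v⟫ := by rw [← add_mul, hab, one_mul]
      simp only [Prod.fst_add, Prod.snd_add, Prod.smul_fst, Prod.smul_snd, smul_eq_mul,
        WithLp.add_fst, WithLp.add_snd, WithLp.smul_fst, WithLp.smul_snd, inner_add_left,
        inner_add_right, real_inner_smul_left, real_inner_smul_right]
      linarith
    · intro p hp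
      have h1 := hge p hp
      have h2 := norm_add_sq_real p.1.fst p.1.snd
      have h3 := sq_nonneg ‖p.1.fst + p.1.snd‖
      rw [WithLp.prod_norm_sq_eq_of_L2]
      linarith
  obtain ⟨⟨x, u⟩, r⟩ := p
  have hr : ⟪x, u⟫ ≤ r := hge _ hp
  have key : ∀ y v, v ∈ A y → ‖x + u‖ ^ 2 ≤ ⟪-u - y, -x - v⟫ := by
    intro y v hv
    have h1 := hmin _ (hgraph y v hv)
    simp only [WithLp.prod_inner_apply, inner_sub_right] at h1
    rw [norm_add_sq_real]
    simp only [inner_sub_left, inner_sub_right, inner_neg_left, inner_neg_right]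
    simp only [real_inner_self_eq_norm_sq, real_inner_comm x] at h1 ⊢
    linarith
  have hmem : -x ∈ A (-u) := hA.2 _ _ fun y v hv => (sq_nonneg _).trans (key y v hv)
  have h0 := key _ _ hmem
  rw [sub_self, inner_zero_left] at h0
  have hxu : x + u = 0 := by
    rw [← norm_eq_zero]
    exact pow_eq_zero_iff two_ne_zero |>.1 (le_antisymm h0 (sq_nonneg _))
  rw [← eq_neg_of_add_eq_zero_left hxu] at hmem
  exact ⟨x, hmem⟩

/-- Minty's theorem. -/
theorem MaximallyMonotoneOp.exists_add_smul_eq [CompleteSpace H] {A : H → Set H}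
    (hA : MaximallyMonotoneOp A) {l : ℝ} (hl : 0 < l) (w : H) :
    ∃ x, ∃ a ∈ A x, x + l • a = w := by
  have hB : MaximallyMonotoneOp fun x => {b | l⁻¹ • (b + w) ∈ A x} := by
    refine ⟨fun x y u v hu hv => ?_, fun x u h => hA.2 _ _ fun y v hv => ?_⟩
    · have := hA.1 _ _ _ _ hu hv
      rw [← smul_sub, add_sub_add_right_eq_sub, real_inner_smul_right] at this
      exact nonneg_of_mul_nonneg_right this (inv_pos.2 hl)
    · have h1 := h y (l • v - w) (by
        change l⁻¹ • (l • v - w + w) ∈ A y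
        rwa [sub_add_cancel, smul_smul, inv_mul_cancel₀ hl.ne', one_smul])
      have h2 : l⁻¹ • (u + w) - v = l⁻¹ • (u - (l • v - w)) := by
        rw [sub_sub_eq_add_sub, smul_sub, smul_smul, inv_mul_cancel₀ hl.ne', one_smul]
      rw [h2, real_inner_smul_right]
      positivity
  obtain ⟨x, hx⟩ := hB.exists_neg_mem
  refine ⟨x, _, hx, ?_⟩
  rw [smul_smul, mul_inv_cancel₀ hl.ne', one_smul]
  abel

theorem MonotoneOp.maximallyMonotoneOp_of_surjective {A : H → Set H} (hA : MonotoneOp A) {l : ℝ}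
    (hl : 0 < l) (h : ∀ w, ∃ x, ∃ a ∈ A x, x + l • a = w) : MaximallyMonotoneOp A := by
  refine ⟨hA, fun x u hxu => ?_⟩
  obtain ⟨y, a, ha, hya⟩ := h (x + l • u)
  have h1 : x - y = -(l • (u - a)) := by
    rw [smul_sub, neg_sub, sub_eq_sub_iff_add_eq_add, add_comm (l • a), hya]
  have h2 := hxu y a ha
  rw [h1, inner_neg_left, real_inner_smul_left, real_inner_self_eq_norm_sq] at h2
  have h3 : ‖u - a‖ = 0 := by
    by_contra hne
    have : 0 < l * ‖u - a‖ ^ 2 := by positivity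
    linarith
  rw [norm_eq_zero, sub_eq_zero] at h3
  rw [h3, sub_self, smul_zero, neg_zero, sub_eq_zero] at h1
  rwa [h1, h3]

theorem MonotoneOp.add {A : H → Set H} (hA : MonotoneOp A) {C : H → H}
    (hC : ∀ x y, 0 ≤ ⟪x - y, C x - C y⟫) :
    MonotoneOp fun x => {w | ∃ a ∈ A x, w = a + C x} := by
  rintro x y _ _ ⟨a, ha, rfl⟩ ⟨b, hb, rfl⟩
  rw [add_sub_add_comm, inner_add_right]
  exact add_nonneg (hA _ _ _ _ ha hb) (hC x y)

theorem maximallyMonotoneOp_singleton {C : H → H} (hC : ∀ x y, 0 ≤ ⟪x - y, C x - C y⟫)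
    (hcont : Continuous C) : MaximallyMonotoneOp fun x => {C x} := by
  refine ⟨?_, fun x u h => ?_⟩
  · rintro x y _ _ rfl rfl
    exact hC x y
  · have h1 : ∀ t : ℝ, 0 < t → 0 ≤ ⟪C x - u, u - C (x - t • (C x - u))⟫ := by
      intro t ht
      have := h (x - t • (C x - u)) _ rfl
      rw [sub_sub_cancel, real_inner_smul_left] at this
      exact nonneg_of_mul_nonneg_right this ht
    have hlim : Tendsto (fun t : ℝ => ⟪C x - u, u - C (x - t • (C x - u))⟫) (𝓝[>] 0)
        (𝓝 ⟪C x - u, u - C x⟫) := by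
      refine tendsto_nhdsWithin_of_tendsto_nhds ?_
      have : Continuous fun t : ℝ => ⟪C x - u, u - C (x - t • (C x - u))⟫ := by fun_prop
      simpa using this.tendsto 0
    have h2 := ge_of_tendsto hlim (by filter_upwards [self_mem_nhdsWithin] with t ht using h1 t ht)
    rw [← neg_sub (C x) u, inner_neg_right, real_inner_self_eq_norm_sq] at h2
    have h3 : ‖C x - u‖ = 0 :=
      pow_eq_zero_iff two_ne_zero |>.1 (le_antisymm (by linarith) (sq_nonneg _))
    rw [norm_eq_zero, sub_eq_zero] at h3
    exact h3.symm

theorem MaximallyMonotoneOp.add_lipschitz [CompleteSpace H] {A : H → Set H}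
    (hA : MaximallyMonotoneOp A) {C : H → H} (hC : ∀ x y, 0 ≤ ⟪x - y, C x - C y⟫) {K : ℝ}
    (hK : 0 < K) (hLip : ∀ x y, ‖C x - C y‖ ≤ K * ‖x - y‖) :
    MaximallyMonotoneOp fun x => {w | ∃ a ∈ A x, w = a + C x} := by
  set l : ℝ := (2 * K)⁻¹ with hldef
  have hl : 0 < l := by positivity
  refine (hA.1.add hC).maximallyMonotoneOp_of_surjective hl fun w => ?_
  choose J a ha hJ using hA.exists_add_smul_eq hl
  have hJ1 : ∀ x y, ‖J x - J y‖ ≤ ‖x - y‖ := by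
    intro x y
    have h1 := hA.1 _ _ _ _ (ha x) (ha y)
    have h2 : x - y = (J x - J y) + l • (a x - a y) := by
      rw [smul_sub, ← add_sub_add_comm, hJ, hJ]
    have h3 := norm_add_sq_real (J x - J y) (l • (a x - a y))
    rw [← h2, real_inner_smul_right] at h3
    have : 0 ≤ l * ⟪J x - J y, a x - a y⟫ := by positivity
    refine le_of_sq_le_sq ?_ (norm_nonneg _)
    nlinarith [sq_nonneg ‖l • (a x - a y)‖]
  have hcontr : ContractingWith (1 / 2) fun y => J (w - l • C y) := by
    refine ⟨by rw [← NNReal.coe_lt_coe]; norm_num, LipschitzWith.of_dist_le_mul fun x y => ?_⟩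
    rw [dist_eq_norm, dist_eq_norm]
    calc ‖J (w - l • C x) - J (w - l • C y)‖
        ≤ ‖(w - l • C x) - (w - l • C y)‖ := hJ1 _ _
      _ = l * ‖C x - C y‖ := by
        rw [sub_sub_sub_cancel_left, ← smul_sub, norm_smul, Real.norm_of_nonneg hl.le,
          norm_sub_rev]
      _ ≤ l * (K * ‖x - y‖) := by gcongr; exact hLip x y
      _ = _ := by
        rw [hldef]
        push_cast
        field_simp
  obtain ⟨y, hy, -⟩ := hcontr.exists_fixedPoint 0 (edist_ne_top _ _)
  have hy' : J (w - l • C y) = y := hy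
  refine ⟨y, _, ⟨a (w - l • C y), ?_, rfl⟩, ?_⟩
  · have := ha (w - l • C y)
    rwa [hy'] at this
  · have := hJ (w - l • C y)
    rw [hy'] at this
    rw [smul_add, ← add_assoc, this, sub_add_cancel]

/-- Solvability of the inclusion in which `C` is replaced by its Yosida approximation. -/
theorem MaximallyMonotoneOp.exists_yosida_solution [CompleteSpace H] {A : H → Set H}
    (hA : MaximallyMonotoneOp A) {C : H → H} (hC : ∀ x y, 0 ≤ ⟪x - y, C x - C y⟫)
    (hcont : Continuous C) {μ : ℝ} (hμ : 0 < μ) (w : H) :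
    ∃ y z, z + μ • C z = y ∧ w - y - C z ∈ A y := by
  have hJ : ∀ y, ∃ z, z + μ • C z = y := by
    intro y
    obtain ⟨z, _, rfl, hz⟩ := (maximallyMonotoneOp_singleton hC hcont).exists_add_smul_eq hμ y
    exact ⟨z, hz⟩
  choose J hJ using hJ
  have hco : ∀ x y, μ * ‖C (J x) - C (J y)‖ ^ 2 ≤ ⟪x - y, C (J x) - C (J y)⟫ := by
    intro x y
    have h1 := hC (J x) (J y)
    have h2 : x - y = (J x - J y) + μ • (C (J x) - C (J y)) := by
      rw [smul_sub, ← add_sub_add_comm, hJ, hJ]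
    conv_rhs => rw [h2, inner_add_left, real_inner_smul_left, real_inner_self_eq_norm_sq]
    linarith
  have hmax := hA.add_lipschitz (C := fun y => C (J y)) (K := μ⁻¹)
    (fun x y => le_trans (by positivity) (hco x y)) (by positivity) (fun x y => by
      have h1 := (hco x y).trans (real_inner_le_norm _ _)
      rw [inv_mul_eq_div, le_div_iff₀ hμ]
      by_contra! hlt
      have h0 : 0 < ‖C (J x) - C (J y)‖ := by
        refine (norm_nonneg _).lt_of_ne' fun h => ?_
        rw [h, zero_mul] at hlt
        exact (norm_nonneg _).not_gt hlt
      nlinarith)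
  obtain ⟨y, _, ⟨a, ha, rfl⟩, hy⟩ := hmax.exists_add_smul_eq one_pos w
  refine ⟨y, J y, hJ y, ?_⟩
  have : w - y - C (J y) = a := by
    rw [← hy, one_smul]
    abel
  rwa [this]

theorem MaximallyMonotoneOp.exists_bound_yosida_solution {A : H → Set H}
    (hA : MaximallyMonotoneOp A) {C : H → H} (hC : ∀ x y, 0 ≤ ⟪x - y, C x - C y⟫)
    (hcont : Continuous C) (w : H) :
    ∃ M : ℝ, ∀ (μ : ℝ) (y z : H), 0 < μ → μ ≤ 1 → z + μ • C z = y → w - y - C z ∈ A y →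
      ‖C z‖ ≤ M := by
  obtain ⟨b, a, ha⟩ := hA.exists_mem
  obtain ⟨r, hr, hball⟩ : ∃ r > 0, ∀ x, ‖x - b‖ ≤ r → ‖C x‖ ≤ ‖C b‖ + 1 := by
    obtain ⟨e, he, h⟩ := Metric.continuousAt_iff.1 hcont.continuousAt 1 one_pos
    refine ⟨e / 2, by positivity, fun x hx => ?_⟩
    have h1 := h (x := x) (by rw [dist_eq_norm]; linarith)
    rw [dist_eq_norm] at h1
    linarith [norm_le_norm_add_norm_sub (C b) (C x), norm_sub_rev (C b) (C x)]
  set k := ‖C b‖ with hk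
  set q := ‖w - b - a‖ with hq
  have hk0 : 0 ≤ k := norm_nonneg _
  have hq0 : 0 ≤ q := norm_nonneg _
  set D := q + 2 * k + 1 with hD
  set T := 1 + 2 * D * (q + k) + k ^ 2 with hT
  refine ⟨(D * q + (k + 1) * (D + T + r)) / r, fun μ y z hμ hμ1 hz hy => ?_⟩
  set s := ‖C z‖ with hs
  set d := ‖y - b‖ with hd
  have hs0 : 0 ≤ s := norm_nonneg _
  have hd0 : 0 ≤ d := norm_nonneg _
  have hzb : z - b = (y - b) - μ • C z := by rw [← hz]; abel
  have hupper : ⟪y - b, C z⟫ ≤ d * q - d ^ 2 := by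
    have h1 := hA.1 _ _ _ _ hy ha
    have h2 : w - y - C z - a = (w - b - a) - (y - b) - C z := by abel
    rw [h2, inner_sub_right, inner_sub_right, real_inner_self_eq_norm_sq] at h1
    linarith [real_inner_le_norm (y - b) (w - b - a)]
  have hest : d ^ 2 + μ * s ^ 2 ≤ d * (q + k) + μ * (s * k) := by
    have h1 := hC z b
    rw [hzb, inner_sub_left, inner_sub_right, inner_sub_right, real_inner_smul_left,
      real_inner_smul_left, real_inner_self_eq_norm_sq] at h1
    have h2 := mul_le_mul_of_nonneg_left (real_inner_le_norm (C z) (C b)) hμ.le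
    have h3 := neg_le_of_abs_le (abs_real_inner_le_norm (y - b) (C b))
    linarith
  have hyoung : μ * (s * k) ≤ μ * s ^ 2 / 2 + k ^ 2 / 2 := by
    nlinarith [mul_nonneg hμ.le (sq_nonneg (s - k)),
      mul_nonneg (sub_nonneg.2 hμ1) (sq_nonneg k)]
  have hμs : 0 ≤ μ * s ^ 2 := by positivity
  have hdD : d ≤ D := by
    by_contra! hlt
    nlinarith [mul_pos (sub_pos.2 hlt) (show 0 < D by positivity)]
  have hμT : μ * s ≤ T := by
    have h1 : d * (q + k) ≤ D * (q + k) := by gcongr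
    have h2 : μ * s ≤ 1 + μ * s ^ 2 := by nlinarith [mul_nonneg hμ.le (sq_nonneg (s - 1))]
    nlinarith [sq_nonneg d]
  have hzT : ‖z - b‖ ≤ D + T := by
    rw [hzb]
    refine (norm_sub_le _ _).trans ?_
    rw [norm_smul, Real.norm_of_nonneg hμ.le]
    exact add_le_add hdD hμT
  have hzC : ⟪z - b, C z⟫ ≤ D * q := by
    rw [hzb, inner_sub_left, real_inner_smul_left, real_inner_self_eq_norm_sq]
    have : d * q ≤ D * q := by gcongr
    nlinarith [sq_nonneg d]
  rw [le_div_iff₀ hr]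
  rcases hs0.eq_or_lt with h0 | hspos
  · rw [← h0, zero_mul]
    positivity
  set e := (r / s) • C z with he
  have hen : ‖e‖ = r := by
    rw [he, norm_smul, Real.norm_of_nonneg (by positivity), ← hs, div_mul_cancel₀ _ hspos.ne']
  have hein : ⟪e, C z⟫ = s * r := by
    rw [he, real_inner_smul_left, real_inner_self_eq_norm_sq, ← hs]
    field_simp
  have hCe : ‖C (b + e)‖ ≤ k + 1 := hball _ (by rw [add_sub_cancel_left, hen])
  have h1 := hC z (b + e)
  have h2 : ⟪z - (b + e), C z⟫ = ⟪z - b, C z⟫ - s * r := by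
    rw [← sub_sub, inner_sub_left, hein]
  have h3 : -⟪z - (b + e), C (b + e)⟫ ≤ (D + T + r) * (k + 1) := by
    refine (neg_le_of_neg_le (neg_le_of_abs_le (abs_real_inner_le_norm _ _))).trans ?_
    have h4 : ‖z - (b + e)‖ ≤ D + T + r := by
      rw [← sub_sub]
      exact (norm_sub_le _ _).trans (add_le_add hzT hen.le)
    gcongr
  rw [inner_sub_right, h2] at h1
  linarith

end Operators

theorem sum_max_monotone_continuous
    {H : Type*} [NormedAddCommGroup H] [InnerProductSpace ℝ H] [CompleteSpace H]
    (A : H → Set H) (hA : MaximallyMonotoneOp A)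
    (C : H → H) (hCmono : ∀ x y : H, 0 ≤ ⟪x - y, C x - C y⟫)
    (hCcont : Continuous C) :
    MaximallyMonotoneOp (fun x => {w | ∃ a ∈ A x, w = a + C x}) := by
  refine (hA.1.add hCmono).maximallyMonotoneOp_of_surjective one_pos fun w => ?_
  have hμ0 : ∀ n : ℕ, 0 < 1 / ((n : ℝ) + 1) := fun n => by positivity
  have hμ1 : ∀ n : ℕ, 1 / ((n : ℝ) + 1) ≤ 1 := fun n => by
    rw [div_le_one (by positivity)]
    linarith [n.cast_nonneg (α := ℝ)]
  choose y z hz hy using fun n : ℕ => hA.exists_yosida_solution hCmono hCcont (hμ0 n) w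
  obtain ⟨M, hM⟩ := hA.exists_bound_yosida_solution hCmono hCcont w
  have hCz : ∀ n, ‖C (z n)‖ ≤ M := fun n => hM _ _ _ (hμ0 n) (hμ1 n) (hz n) (hy n)
  have hM0 : 0 ≤ M := (norm_nonneg _).trans (hCz 0)
  have hcau : CauchySeq y := by
    refine cauchySeq_of_norm_sub_sq_le (c := 2 * M ^ 2) fun n m => ?_
    have h1 := hA.1 _ _ _ _ (hy n) (hy m)
    have h2 : w - y n - C (z n) - (w - y m - C (z m)) = -(y n - y m) - (C (z n) - C (z m)) := by
      abel
    rw [h2, inner_sub_right, inner_neg_right, real_inner_self_eq_norm_sq] at h1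
    have h3 : y n - y m = (z n - z m) +
        ((1 / ((n : ℝ) + 1)) • C (z n) - (1 / ((m : ℝ) + 1)) • C (z m)) := by
      rw [← add_sub_add_comm, hz, hz]
    have h4 : ⟪y n - y m, C (z n) - C (z m)⟫ = ⟪z n - z m, C (z n) - C (z m)⟫ +
        ⟪(1 / ((n : ℝ) + 1)) • C (z n) - (1 / ((m : ℝ) + 1)) • C (z m), C (z n) - C (z m)⟫ := by
      rw [← inner_add_left, ← h3]
    have h5 : ‖(1 / ((n : ℝ) + 1)) • C (z n) - (1 / ((m : ℝ) + 1)) • C (z m)‖ ≤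
        (1 / ((n : ℝ) + 1) + 1 / ((m : ℝ) + 1)) * M := by
      refine (norm_sub_le _ _).trans ?_
      rw [norm_smul, norm_smul, Real.norm_of_nonneg (hμ0 n).le, Real.norm_of_nonneg (hμ0 m).le,
        add_mul]
      have := hCz n
      have := hCz m
      gcongr
    have h6 : ‖C (z n) - C (z m)‖ ≤ M + M :=
      (norm_sub_le _ _).trans (add_le_add (hCz n) (hCz m))
    have h7 := neg_le_of_abs_le ((abs_real_inner_le_norm _ _).trans
      (mul_le_mul h5 h6 (norm_nonneg _) (by positivity)))
    linarith [hCmono (z n) (z m)]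
  obtain ⟨x, hx⟩ := cauchySeq_tendsto_of_complete hcau
  have hzx : Tendsto z atTop (𝓝 x) := by
    have h1 : Tendsto (fun n : ℕ => (1 / ((n : ℝ) + 1)) • C (z n)) atTop (𝓝 0) := by
      refine squeeze_zero_norm (a := fun n : ℕ => 1 / ((n : ℝ) + 1) * M) (fun n => ?_) ?_
      · rw [norm_smul, Real.norm_of_nonneg (hμ0 n).le]
        have := hCz n
        gcongr
      · simpa using (tendsto_one_div_add_atTop_nhds_zero_nat (𝕜 := ℝ)).mul_const M
    have h2 := hx.sub h1
    rw [sub_zero] at h2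
    refine h2.congr fun n => ?_
    rw [← hz n, add_sub_cancel_right]
  have hmem : w - x - C x ∈ A x :=
    hA.mem_of_tendsto hx ((hx.const_sub w).sub ((hCcont.tendsto x).comp hzx)) hy
  refine ⟨x, _, ⟨_, hmem, rfl⟩, ?_⟩
  rw [one_smul]
  abel
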